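/- Let X and X̂ be ℝ^d-valued random vectors defined on the same probability space, and suppose H(⌊X̂⌋), H(⌊X−X̂⌋), and the joint entropy H(⌊X⌋, ⌊X̂⌋) are finite. Then H(⌊X⌋, ⌊X̂⌋) ≤ H(⌊X̂⌋) + H(⌊X−X̂⌋) + d·log 2; equivalently, the conditional entropy H(⌊X⌋ | ⌊X̂⌋) is at most H(⌊X−X̂⌋) + d·log 2. -/

import Mathlib

open MeasureTheory ProbabilityTheory Real Filter Topology
open scoped ENNReal

/-- Componentwise integer part of a vector in ℝ^d. -/
noncomputable def intFloor (d : ℕ) (x : Fin d → ℝ) : Fin d → ℤ := fun i => ⌊x i⌋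

/-- Discrete (Shannon) entropy, in nats, of the random element `V` under `P`,
valued in `[0,∞]`. -/
noncomputable def discEnt {Ω α : Type*} [MeasurableSpace Ω] (P : Measure Ω) (V : Ω → α) : ℝ≥0∞ :=
  ∑' a : α, ENNReal.ofReal (Real.negMulLog (P (V ⁻¹' {a})).toReal)

/-- Differential entropy of a measure on ℝ^d (w.r.t. Lebesgue measure),
as a Bochner integral of `-f log f` where `f` is the Radon–Nikodym density. -/
noncomputable def diffEnt {d : ℕ} (μ : Measure (Fin d → ℝ)) : ℝ :=
  -∫ x, ((μ.rnDeriv volume x).toReal) * Real.log ((μ.rnDeriv volume x).toReal)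

open Classical in
/-- Kullback–Leibler divergence of `μ` w.r.t. `ν`, valued in `[0,∞]`. -/
noncomputable def klDiv {α : Type*} [MeasurableSpace α] (μ ν : Measure α) : ℝ≥0∞ :=
  if μ ≪ ν ∧ Integrable (llr μ ν) μ then ENNReal.ofReal (∫ x, llr μ ν x ∂μ) else ⊤

/-- Entropy as the expected information content. -/
theorem discEnt_eq_lintegral {Ω α : Type*} [MeasurableSpace Ω] (P : Measure Ω)
    [IsProbabilityMeasure P] [Countable α] [MeasurableSpace α] [MeasurableSingletonClass α]
    {V : Ω → α} (hV : Measurable V) :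
    discEnt P V = ∫⁻ ω, ENNReal.ofReal (-Real.log (P (V ⁻¹' {V ω})).toReal) ∂P := by
  rw [← lintegral_map (μ := P)
    (f := fun a => ENNReal.ofReal (-Real.log (P (V ⁻¹' {a})).toReal)) (measurable_of_countable _) hV,
    lintegral_countable', discEnt]
  refine tsum_congr fun a => ?_
  rw [Measure.map_apply hV (measurableSet_singleton a), Real.negMulLog, neg_mul_comm,
    ENNReal.ofReal_mul ENNReal.toReal_nonneg, ENNReal.ofReal_toReal (measure_ne_top _ _), mul_comm]

theorem ae_measure_preimage_singleton_ne_zero {Ω α : Type*} [MeasurableSpace Ω] (P : Measure Ω)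
    [Countable α] (V : Ω → α) : ∀ᵐ ω ∂P, P (V ⁻¹' {V ω}) ≠ 0 := by
  have h : ∀ᵐ ω ∂P, ∀ a, P (V ⁻¹' {a}) = 0 → V ω ≠ a := by
    refine ae_all_iff.2 fun a => ?_
    by_cases ha : P (V ⁻¹' {a}) = 0
    · filter_upwards [measure_eq_zero_iff_ae_notMem.1 ha] with ω hω _ h
      exact hω h
    · exact ae_of_all _ fun ω h => absurd h ha
  filter_upwards [h] with ω hω h0
  exact hω _ h0 rfl

theorem tsum_measure_preimage_singleton_eq_one {Ω α : Type*} [MeasurableSpace Ω] (P : Measure Ω)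
    [IsProbabilityMeasure P] [Countable α] [MeasurableSpace α] [MeasurableSingletonClass α]
    {V : Ω → α} (hV : Measurable V) : ∑' a, P (V ⁻¹' {a}) = 1 := by
  have h := lintegral_countable' (μ := P.map V) (fun _ => 1)
  simp only [lintegral_one, one_mul, Measure.map_apply hV (measurableSet_singleton _),
    Measure.map_apply hV MeasurableSet.univ, Set.preimage_univ, measure_univ] at h
  exact h.symm

theorem Real.negMulLog_add_self_le {p q : ℝ} (hp : 0 ≤ p) (hq : 0 ≤ q) (hpq : p ≠ 0 → q ≠ 0) :
    Real.negMulLog p + p ≤ p * -Real.log q + q := by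
  rcases hp.eq_or_lt with rfl | hp
  · simpa using hq
  have hq : 0 < q := lt_of_le_of_ne hq (hpq hp.ne').symm
  have h := mul_le_mul_of_nonneg_left (Real.log_le_sub_one_of_pos (div_pos hq hp)) hp.le
  rw [Real.log_div hq.ne' hp.ne', mul_sub, mul_sub, mul_div_cancel₀ _ hp.ne'] at h
  rw [Real.negMulLog]
  linarith

/-- Gibbs' inequality: entropy is at most the cross entropy relative to a sub-probability. -/
theorem discEnt_le_lintegral_neg_log {Ω α : Type*} [MeasurableSpace Ω] (P : Measure Ω)
    [IsProbabilityMeasure P] [Countable α] [MeasurableSpace α] [MeasurableSingletonClass α]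
    {V : Ω → α} (hV : Measurable V) (q : α → ℝ≥0∞) (hq : ∑' a, q a ≤ 1)
    (hVq : ∀ a, P (V ⁻¹' {a}) ≠ 0 → q a ≠ 0) :
    discEnt P V ≤ ∫⁻ ω, ENNReal.ofReal (-Real.log (q (V ω)).toReal) ∂P := by
  rw [← lintegral_map (μ := P)
    (f := fun a => ENNReal.ofReal (-Real.log (q a).toReal)) (measurable_of_countable _) hV,
    lintegral_countable', discEnt]
  simp only [Measure.map_apply hV (measurableSet_singleton _)]
  have hq1 a : q a ≤ 1 := (ENNReal.le_tsum a).trans hq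
  refine (ENNReal.add_le_add_iff_right ENNReal.one_ne_top).1
    (le_trans ?_ (add_le_add_right hq _))
  nth_rw 1 [← tsum_measure_preimage_singleton_eq_one P hV]
  rw [← ENNReal.tsum_add, ← ENNReal.tsum_add]
  refine ENNReal.tsum_le_tsum fun a => ?_
  have hqt : q a ≠ ⊤ := ne_top_of_le_ne_top ENNReal.one_ne_top (hq1 a)
  have hpt : P (V ⁻¹' {a}) ≠ ⊤ := measure_ne_top _ _
  have hlog : 0 ≤ -Real.log (q a).toReal := neg_nonneg.2 <|
    Real.log_nonpos ENNReal.toReal_nonneg (ENNReal.toReal_mono ENNReal.one_ne_top (hq1 a))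
  have hp1 : (P (V ⁻¹' {a})).toReal ≤ 1 := ENNReal.toReal_mono ENNReal.one_ne_top prob_le_one
  have h := Real.negMulLog_add_self_le (p := (P (V ⁻¹' {a})).toReal) (q := (q a).toReal)
    ENNReal.toReal_nonneg ENNReal.toReal_nonneg fun h0 =>
      ENNReal.toReal_ne_zero.2 ⟨hVq a (ENNReal.toReal_ne_zero.1 h0).1, hqt⟩
  calc ENNReal.ofReal (Real.negMulLog (P (V ⁻¹' {a})).toReal) + P (V ⁻¹' {a})
      = ENNReal.ofReal (Real.negMulLog (P (V ⁻¹' {a})).toReal + (P (V ⁻¹' {a})).toReal) := by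
        rw [ENNReal.ofReal_add (Real.negMulLog_nonneg ENNReal.toReal_nonneg hp1)
          ENNReal.toReal_nonneg, ENNReal.ofReal_toReal hpt]
    _ ≤ _ := ENNReal.ofReal_le_ofReal h
    _ = _ := by
        rw [ENNReal.ofReal_add (mul_nonneg ENNReal.toReal_nonneg hlog) ENNReal.toReal_nonneg,
          ENNReal.ofReal_mul ENNReal.toReal_nonneg, ENNReal.ofReal_toReal hpt,
          ENNReal.ofReal_toReal hqt, mul_comm]

theorem measurable_intFloor (d : ℕ) : Measurable (intFloor d) :=
  measurable_pi_lambda _ fun i => Int.measurable_floor.comp (measurable_pi_apply i)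

theorem exists_intFloor_eq_add_add (d : ℕ) (x y : Fin d → ℝ) :
    ∃ e : Fin d → Fin 2,
      intFloor d x = intFloor d y + intFloor d (x - y) + fun i => ((e i : ℕ) : ℤ) := by
  have h i : ∃ k : Fin 2, ⌊x i⌋ = ⌊y i⌋ + ⌊x i - y i⌋ + ((k : ℕ) : ℤ) := by
    have h₁ := Int.le_floor_add (y i) (x i - y i)
    have h₂ := Int.le_floor_add_floor (y i) (x i - y i)
    rw [add_sub_cancel] at h₁ h₂
    refine ⟨⟨(⌊x i⌋ - ⌊y i⌋ - ⌊x i - y i⌋).toNat, by omega⟩, ?_⟩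
    simp only
    omega
  choose e he using h
  exact ⟨e, funext he⟩

/-- If `A = B + C + ε` with `ε` in a finite family indexed by `E`, then
`H(A, B) ≤ H(B) + H(C) + log |E|`. -/
theorem discEnt_prodMk_le {Ω G E : Type*} [MeasurableSpace Ω] (P : Measure Ω)
    [IsProbabilityMeasure P] [AddCommGroup G] [Countable G] [MeasurableSpace G]
    [MeasurableSingletonClass G] [Fintype E] [Nonempty E] (t : E → G) {A B C : Ω → G}
    (hA : Measurable A) (hB : Measurable B) (hC : Measurable C)
    (h : ∀ ω, ∃ e, A ω = B ω + C ω + t e) :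
    discEnt P (fun ω => (A ω, B ω)) ≤
      discEnt P B + discEnt P C + ENNReal.ofReal (Real.log (Fintype.card E)) := by
  let n : ℝ≥0∞ := Fintype.card E
  have hn0 : n ≠ 0 := by simp [n]
  have hnt : n ≠ ⊤ := ENNReal.natCast_ne_top _
  let q : G × G → ℝ≥0∞ := fun x => P (B ⁻¹' {x.2}) * (n⁻¹ * ∑ e, P (C ⁻¹' {x.1 - (x.2 + t e)}))
  have hq : ∑' x, q x ≤ 1 := by
    have hshift (b : G) : ∑' a, n⁻¹ * ∑ e, P (C ⁻¹' {a - (b + t e)}) = 1 := by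
      rw [ENNReal.tsum_mul_left, Summable.tsum_finsetSum fun _ _ => ENNReal.summable]
      have (e : E) : ∑' a, P (C ⁻¹' {a - (b + t e)}) = 1 := by
        rw [← tsum_measure_preimage_singleton_eq_one P hC]
        exact (Equiv.subRight (b + t e)).tsum_eq fun c => P (C ⁻¹' {c})
      simp only [this, Finset.sum_const, nsmul_eq_mul, mul_one, Finset.card_univ]
      exact ENNReal.inv_mul_cancel hn0 hnt
    rw [ENNReal.tsum_prod', ENNReal.tsum_comm]
    simp only [q, ENNReal.tsum_mul_left, hshift, mul_one]
    exact (tsum_measure_preimage_singleton_eq_one P hB).le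
  have hqle (ω : Ω) : P (B ⁻¹' {B ω}) * (n⁻¹ * P (C ⁻¹' {C ω})) ≤ q (A ω, B ω) := by
    obtain ⟨e, he⟩ := h ω
    have hc : A ω - (B ω + t e) = C ω := by rw [he]; abel
    have := Finset.single_le_sum (f := fun e => P (C ⁻¹' {A ω - (B ω + t e)}))
      (fun _ _ => zero_le) (Finset.mem_univ e)
    simp only [hc] at this
    dsimp only [q]
    gcongr
  have hpos : ∀ᵐ ω ∂P, q (A ω, B ω) ≠ 0 ∧ -Real.log (q (A ω, B ω)).toReal ≤
      -Real.log (P (B ⁻¹' {B ω})).toReal + -Real.log (P (C ⁻¹' {C ω})).toReal +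
        Real.log (Fintype.card E) := by
    filter_upwards [ae_measure_preimage_singleton_ne_zero P B,
      ae_measure_preimage_singleton_ne_zero P C] with ω hb hc
    have hne : P (B ⁻¹' {B ω}) * (n⁻¹ * P (C ⁻¹' {C ω})) ≠ 0 :=
      mul_ne_zero hb (mul_ne_zero (ENNReal.inv_ne_zero.2 hnt) hc)
    have hqt : q (A ω, B ω) ≠ ⊤ :=
      ne_top_of_le_ne_top ENNReal.one_ne_top ((ENNReal.le_tsum _).trans hq)
    have hb' : (P (B ⁻¹' {B ω})).toReal ≠ 0 := ENNReal.toReal_ne_zero.2 ⟨hb, measure_ne_top _ _⟩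
    have hc' : (P (C ⁻¹' {C ω})).toReal ≠ 0 := ENNReal.toReal_ne_zero.2 ⟨hc, measure_ne_top _ _⟩
    have hn' : ((Fintype.card E : ℝ))⁻¹ ≠ 0 := by simp
    refine ⟨fun h0 => hne (le_zero_iff.1 (h0 ▸ hqle ω)), ?_⟩
    have hlog := Real.log_le_log
      (ENNReal.toReal_pos hne (ne_top_of_le_ne_top hqt (hqle ω))) (ENNReal.toReal_mono hqt (hqle ω))
    rw [ENNReal.toReal_mul, ENNReal.toReal_mul, ENNReal.toReal_inv, ENNReal.toReal_natCast,
      Real.log_mul hb' (mul_ne_zero hn' hc'), Real.log_mul hn' hc', Real.log_inv] at hlog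
    linarith
  have hAB : Measurable fun ω => (A ω, B ω) := hA.prodMk hB
  have hVq : ∀ x, P ((fun ω => (A ω, B ω)) ⁻¹' {x}) ≠ 0 → q x ≠ 0 := by
    intro x hx h0
    refine hx (measure_eq_zero_iff_ae_notMem.2 ?_)
    filter_upwards [hpos] with ω hω hmem
    exact hω.1 (by rw [show (A ω, B ω) = x from hmem, h0])
  have hmeas {V : Ω → G} (hV : Measurable V) :
      Measurable fun ω => ENNReal.ofReal (-Real.log (P (V ⁻¹' {V ω})).toReal) :=
    (measurable_of_countable fun a => ENNReal.ofReal (-Real.log (P (V ⁻¹' {a})).toReal)).comp hV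
  rw [discEnt_eq_lintegral P hB, discEnt_eq_lintegral P hC, ← lintegral_add_left (hmeas hB)]
  calc discEnt P (fun ω => (A ω, B ω))
      ≤ ∫⁻ ω, ENNReal.ofReal (-Real.log (q (A ω, B ω)).toReal) ∂P :=
        discEnt_le_lintegral_neg_log P hAB q hq hVq
    _ ≤ ∫⁻ ω, (ENNReal.ofReal (-Real.log (P (B ⁻¹' {B ω})).toReal) +
          ENNReal.ofReal (-Real.log (P (C ⁻¹' {C ω})).toReal)) +
          ENNReal.ofReal (Real.log (Fintype.card E)) ∂P := by
        refine lintegral_mono_ae ?_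
        filter_upwards [hpos] with ω hω
        refine (ENNReal.ofReal_le_ofReal hω.2).trans (ENNReal.ofReal_add_le.trans ?_)
        gcongr
        exact ENNReal.ofReal_add_le
    _ = _ := by
        rw [lintegral_add_right _ measurable_const, lintegral_const, measure_univ, mul_one]

/-- `H(⌊X⌋, ⌊X̂⌋) ≤ H(⌊X̂⌋) + H(⌊X−X̂⌋) + d·log 2`; equivalently
`H(⌊X⌋ | ⌊X̂⌋) ≤ H(⌊X−X̂⌋) + d·log 2`. -/
theorem jointFloorEntropy_le
    {Ω : Type*} [MeasurableSpace Ω] (P : Measure Ω) [IsProbabilityMeasure P]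
    (d : ℕ)
    (X Xhat : Ω → (Fin d → ℝ)) (hX : Measurable X) (hXhat : Measurable Xhat)
    (h1 : discEnt P (fun ω => intFloor d (Xhat ω)) ≠ ⊤)
    (h2 : discEnt P (fun ω => intFloor d (X ω - Xhat ω)) ≠ ⊤)
    (h3 : discEnt P (fun ω => (intFloor d (X ω), intFloor d (Xhat ω))) ≠ ⊤) :
    discEnt P (fun ω => (intFloor d (X ω), intFloor d (Xhat ω))) ≤
        discEnt P (fun ω => intFloor d (Xhat ω)) +
          discEnt P (fun ω => intFloor d (X ω - Xhat ω)) +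
          (d : ℝ≥0∞) * ENNReal.ofReal (Real.log 2) ∧
      discEnt P (fun ω => (intFloor d (X ω), intFloor d (Xhat ω))) -
          discEnt P (fun ω => intFloor d (Xhat ω)) ≤
        discEnt P (fun ω => intFloor d (X ω - Xhat ω)) +
          (d : ℝ≥0∞) * ENNReal.ofReal (Real.log 2) := by
  have hle := discEnt_prodMk_le P (fun (e : Fin d → Fin 2) i => ((e i : ℕ) : ℤ))
    ((measurable_intFloor d).comp hX) ((measurable_intFloor d).comp hXhat)
    ((measurable_intFloor d).comp (hX.sub hXhat))
    fun ω => exists_intFloor_eq_add_add d (X ω) (Xhat ω)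
  have hcard : ENNReal.ofReal (Real.log (Fintype.card (Fin d → Fin 2))) =
      (d : ℝ≥0∞) * ENNReal.ofReal (Real.log 2) := by
    rw [Fintype.card_fun, Fintype.card_fin, Fintype.card_fin, Nat.cast_pow, Real.log_pow,
      ENNReal.ofReal_mul (Nat.cast_nonneg d), ENNReal.ofReal_natCast, Nat.cast_ofNat]
  rw [hcard] at hle
  exact ⟨hle, tsub_le_iff_left.2 (hle.trans_eq (add_assoc _ _ _))⟩
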